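/- (Hestir–Williams necessary condition.) Let X and Y be subsets of complete separable metric spaces equipped with Borel probability measures μ on X and ν on Y. If γ ∈ Γ(μ,ν) is extremal in Γ(μ,ν), then there exists a numbered limb system S ⊂ X × Y such that γ vanishes outside S. -/

import Mathlib

open MeasureTheory Set

/-- A **numbered limb system** on `X × Y` (Hestir–Williams).  There are countable disjoint
decompositions `X = ⋃ᵢ I_{2i+1}` and `Y = ⋃ᵢ I_{2i}`, together with maps
`f_{2i+1} : Dom(f_{2i+1}) ⊆ X → Y` (here `fodd i` with domain `domOdd i`) and
`f_{2i} : Dom(f_{2i}) ⊆ Y → X` (here `feven i` with domain `domEven i`) such that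
`Dom(f_k) ∪ Ran(f_{k+1}) ⊆ I_k` for every `k ≥ 0`.  The system itself is the set
`S = ⋃_{i≥1} Graph(f_{2i-1}) ∪ Antigraph(f_{2i})`, recorded below as `limbSet`. -/
structure NumberedLimbSystem (X Y : Type*) where
  /-- `fodd i` is the map `f_{2i+1} : X → Y` (only its values on `domOdd i` matter). -/
  fodd : ℕ → X → Y
  /-- `domOdd i` is `Dom (f_{2i+1}) ⊆ X`. -/
  domOdd : ℕ → Set X
  /-- `feven i` is the map `f_{2i} : Y → X` (only its values on `domEven i` matter). -/
  feven : ℕ → Y → X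
  /-- `domEven i` is `Dom (f_{2i}) ⊆ Y`. -/
  domEven : ℕ → Set Y
  /-- `Iodd i` is the piece `I_{2i+1}` of the decomposition of `X`. -/
  Iodd : ℕ → Set X
  /-- `Ieven i` is the piece `I_{2i}` of the decomposition of `Y`. -/
  Ieven : ℕ → Set Y
  disjoint_Iodd : ∀ i j, i ≠ j → Disjoint (Iodd i) (Iodd j)
  union_Iodd : ⋃ i, Iodd i = Set.univ
  disjoint_Ieven : ∀ i j, i ≠ j → Disjoint (Ieven i) (Ieven j)
  union_Ieven : ⋃ i, Ieven i = Set.univ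
  /-- `Dom(f_{2i}) ∪ Ran(f_{2i+1}) ⊆ I_{2i}`. -/
  even_subset : ∀ i, domEven i ∪ (fodd i '' domOdd i) ⊆ Ieven i
  /-- `Dom(f_{2i+1}) ∪ Ran(f_{2i+2}) ⊆ I_{2i+1}`. -/
  odd_subset : ∀ i, domOdd i ∪ (feven (i + 1) '' domEven (i + 1)) ⊆ Iodd i

namespace NumberedLimbSystem

variable {X Y : Type*} (L : NumberedLimbSystem X Y)

/-- `Graph(f_{2i+1}) = {(x, f_{2i+1}(x)) : x ∈ Dom f_{2i+1}} ⊆ X × Y`. -/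
def graph (i : ℕ) : Set (X × Y) :=
  {p : X × Y | p.1 ∈ L.domOdd i ∧ p.2 = L.fodd i p.1}

/-- `Antigraph(f_{2i}) = {(f_{2i}(y), y) : y ∈ Dom f_{2i}} ⊆ X × Y`. -/
def antigraph (i : ℕ) : Set (X × Y) :=
  {p : X × Y | p.2 ∈ L.domEven i ∧ p.1 = L.feven i p.2}

/-- The numbered limb system as a subset of `X × Y`:
`S = ⋃_{i=1}^∞ Graph(f_{2i-1}) ∪ Antigraph(f_{2i})`. -/
def limbSet : Set (X × Y) :=
  (⋃ i, L.graph i) ∪ ⋃ i, L.antigraph (i + 1)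

/-- The system has (at most) `N` limbs: `Dom(f_k) = ∅` for all `k > N`. -/
def HasAtMostLimbs (N : ℕ) : Prop :=
  (∀ i, 2 * i + 1 > N → L.domOdd i = ∅) ∧ ∀ i, 2 * i > N → L.domEven i = ∅

end NumberedLimbSystem

/-- `Γ(μ,ν)`: the set of non-negative Borel measures on `X × Y` with marginals `μ` and `ν`. -/
def IsCoupling {X Y : Type*} [MeasurableSpace X] [MeasurableSpace Y]
    (γ : MeasureTheory.Measure (X × Y)) (μ : MeasureTheory.Measure X)
    (ν : MeasureTheory.Measure Y) : Prop :=
  γ.map Prod.fst = μ ∧ γ.map Prod.snd = ν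

open scoped NNReal

/-- `γ` is extremal in the convex set `Γ(μ,ν)`. -/
def IsExtremalCoupling {X Y : Type*} [MeasurableSpace X] [MeasurableSpace Y]
    (γ : Measure (X × Y)) (μ : Measure X) (ν : Measure Y) : Prop :=
  IsCoupling γ μ ν ∧
    ∀ (γ₀ γ₁ : Measure (X × Y)) (t : ℝ≥0), 0 < t → t < 1 →
      IsCoupling γ₀ μ ν → IsCoupling γ₁ μ ν →
      γ = (1 - t) • γ₀ + t • γ₁ → γ₀ = γ₁

/-- A contraction `φ : L¹(γ) → ℝ` gives a finite measure `A ↦ γ A + φ 1_A`. -/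
lemma exists_measure_real_eq_add_dual {α : Type*} [MeasurableSpace α] (γ : Measure α)
    [IsFiniteMeasure γ] (φ : StrongDual ℝ (Lp ℝ 1 γ)) (hφ : ‖φ‖ ≤ 1) :
    ∃ ρ : Measure α, IsFiniteMeasure ρ ∧ ∀ (A : Set α) (hA : MeasurableSet A),
      ρ.real A = γ.real A + φ (indicatorConstLp 1 hA (measure_ne_top γ A) (1 : ℝ)) := by
  classical
  have hbound : ∀ (A : Set α) (hA : MeasurableSet A),
      ‖φ (indicatorConstLp 1 hA (measure_ne_top γ A) (1 : ℝ))‖ ≤ γ.real A := by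
    intro A hA
    refine (φ.le_of_opNorm_le hφ _).trans ?_
    rw [norm_indicatorConstLp one_ne_zero ENNReal.one_ne_top]
    simp
  let m : SignedMeasure α := VectorMeasure.of_additive_of_le_measure (μ := γ)
    (fun A ↦ if hA : MeasurableSet A then
      φ (indicatorConstLp 1 hA (measure_ne_top γ A) (1 : ℝ)) else 0)
    (fun A ↦ by
      by_cases hA : MeasurableSet A
      · simp only [hA, dite_true]
        rw [← ofReal_norm, ← ofReal_measureReal]
        exact ENNReal.ofReal_le_ofReal (hbound A hA)
      · simp [hA])
    (fun s t hs ht hst ↦ by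
      simp only [hs, ht, hs.union ht, dite_true]
      rw [indicatorConstLp_disjoint_union hs ht (measure_ne_top γ s) (measure_ne_top γ t) hst,
        map_add])
    (fun s hs ↦ by simp [hs])
  have hm : ∀ (A : Set α) (hA : MeasurableSet A), (γ.toSignedMeasure + m) A =
      γ.real A + φ (indicatorConstLp 1 hA (measure_ne_top γ A) (1 : ℝ)) := by
    intro A hA
    rw [add_apply, Measure.toSignedMeasure_apply_measurable hA]
    congr 1
    change (if hA : MeasurableSet A then
      φ (indicatorConstLp 1 hA (measure_ne_top γ A) (1 : ℝ)) else 0) = _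
    rw [dif_pos hA]
  have h_nonneg : 0 ≤[univ] (γ.toSignedMeasure + m) := by
    refine VectorMeasure.restrict_le_restrict_of_subset_le _ _ fun A hA _ ↦ ?_
    rw [hm A hA, zero_apply]
    linarith [(abs_le.1 (hbound A hA)).1]
  refine ⟨SignedMeasure.toMeasureOfZeroLE _ univ MeasurableSet.univ h_nonneg, inferInstance,
    fun A hA ↦ ?_⟩
  rw [SignedMeasure.toMeasureOfZeroLE_real_apply _ h_nonneg MeasurableSet.univ hA, univ_inter,
    hm A hA]

/-- A continuous linear functional separating a point from the closure of a subspace. -/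
lemma Submodule.exists_strongDual_eq_zero_of_notMem_topologicalClosure {E : Type*}
    [NormedAddCommGroup E] [NormedSpace ℝ E] (V : Submodule ℝ E) {x : E}
    (hx : x ∉ V.topologicalClosure) :
    ∃ φ : StrongDual ℝ E, ‖φ‖ ≤ 1 ∧ (∀ v ∈ V, φ v = 0) ∧ φ x ≠ 0 := by
  obtain ⟨φ, u, hu, hux⟩ := geometric_hahn_banach_closed_point
    V.topologicalClosure.convex V.isClosed_topologicalClosure hx
  have hu0 : 0 < u := by simpa using hu 0 (zero_mem _)
  have hV : ∀ v ∈ V, φ v = 0 := by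
    intro v hv
    by_contra hne
    have := hu ((u / φ v) • v) (V.le_topologicalClosure (V.smul_mem _ hv))
    rw [map_smul, smul_eq_mul, div_mul_cancel₀ _ hne] at this
    exact lt_irrefl _ this
  have hpos : 0 < ‖φ‖ := norm_pos_iff.2 fun h ↦ by simp [h] at hux; linarith
  refine ⟨‖φ‖⁻¹ • φ, ?_, fun v hv ↦ by simp [hV v hv], ?_⟩
  · rw [norm_smul, norm_inv, norm_norm, inv_mul_cancel₀ hpos.ne']
  · exact mul_ne_zero (inv_ne_zero hpos.ne') (hu0.trans hux).ne'

/-- The subspace of `L¹(γ)` of functions of the form `f(x) + g(y)`. -/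
def separableSumLp {X Y : Type*} [MeasurableSpace X] [MeasurableSpace Y]
    (γ : Measure (X × Y)) : Submodule ℝ (Lp ℝ 1 γ) where
  carrier := {h | ∃ (f : X → ℝ) (g : Y → ℝ), ∀ᵐ z ∂γ, h z = f z.1 + g z.2}
  add_mem' := by
    rintro h₁ h₂ ⟨f₁, g₁, h1⟩ ⟨f₂, g₂, h2⟩
    refine ⟨f₁ + f₂, g₁ + g₂, ?_⟩
    filter_upwards [h1, h2, Lp.coeFn_add h₁ h₂] with z hz1 hz2 hz
    simp only [hz, Pi.add_apply, hz1, hz2]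
    ring
  zero_mem' := ⟨0, 0, by
    filter_upwards [Lp.coeFn_zero ℝ 1 γ] with z hz
    exact hz.trans (by simp)⟩
  smul_mem' := by
    rintro c h ⟨f, g, hfg⟩
    refine ⟨c • f, c • g, ?_⟩
    filter_upwards [hfg, Lp.coeFn_smul c h] with z hz1 hz
    simp only [hz, Pi.smul_apply, hz1, smul_eq_mul]
    ring

section Extremal

variable {X Y : Type*} [MeasurableSpace X] [MeasurableSpace Y] {γ : Measure (X × Y)}
  {μ : Measure X} {ν : Measure Y}

lemma indicatorConstLp_mem_separableSumLp_of_preimage_fst [IsFiniteMeasure γ] {B : Set X}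
    (hB : MeasurableSet (Prod.fst ⁻¹' B : Set (X × Y))) :
    indicatorConstLp 1 hB (measure_ne_top γ _) (1 : ℝ) ∈ separableSumLp γ := by
  refine ⟨B.indicator fun _ ↦ 1, 0, ?_⟩
  filter_upwards [indicatorConstLp_coeFn (p := 1) (hs := hB) (hμs := measure_ne_top γ _)
    (c := (1 : ℝ))] with z hz
  rw [hz, Pi.zero_apply, add_zero]
  rfl

lemma indicatorConstLp_mem_separableSumLp_of_preimage_snd [IsFiniteMeasure γ] {B : Set Y}
    (hB : MeasurableSet (Prod.snd ⁻¹' B : Set (X × Y))) :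
    indicatorConstLp 1 hB (measure_ne_top γ _) (1 : ℝ) ∈ separableSumLp γ := by
  refine ⟨0, B.indicator fun _ ↦ 1, ?_⟩
  filter_upwards [indicatorConstLp_coeFn (p := 1) (hs := hB) (hμs := measure_ne_top γ _)
    (c := (1 : ℝ))] with z hz
  rw [hz, Pi.zero_apply, zero_add]
  rfl

/-- Perturbing a coupling by a functional that kills the functions `f(x) + g(y)` gives a
coupling with the same marginals. -/
lemma IsCoupling.of_real_eq_add_dual [IsFiniteMeasure γ] (hγ : IsCoupling γ μ ν)
    {φ : StrongDual ℝ (Lp ℝ 1 γ)} (hφ : ∀ h ∈ separableSumLp γ, φ h = 0)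
    {ρ : Measure (X × Y)} [IsFiniteMeasure ρ]
    (hρ : ∀ (A : Set (X × Y)) (hA : MeasurableSet A),
      ρ.real A = γ.real A + φ (indicatorConstLp 1 hA (measure_ne_top γ A) (1 : ℝ))) :
    IsCoupling ρ μ ν := by
  constructor
  · rw [← hγ.1]
    ext B hB
    rw [Measure.map_apply measurable_fst hB, Measure.map_apply measurable_fst hB,
      ← measureReal_eq_measureReal_iff, hρ _ (measurable_fst hB),
      hφ _ (indicatorConstLp_mem_separableSumLp_of_preimage_fst _), add_zero]
  · rw [← hγ.2]
    ext B hB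
    rw [Measure.map_apply measurable_snd hB, Measure.map_apply measurable_snd hB,
      ← measureReal_eq_measureReal_iff, hρ _ (measurable_snd hB),
      hφ _ (indicatorConstLp_mem_separableSumLp_of_preimage_snd _), add_zero]

/-- For an extremal coupling, indicators lie in the closure of the functions `f(x) + g(y)`. -/
lemma IsExtremalCoupling.indicatorConstLp_mem_topologicalClosure [IsFiniteMeasure γ]
    (hγ : IsExtremalCoupling γ μ ν) {A : Set (X × Y)} (hA : MeasurableSet A) :
    indicatorConstLp 1 hA (measure_ne_top γ A) (1 : ℝ) ∈
      (separableSumLp γ).topologicalClosure := by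
  by_contra hx
  obtain ⟨φ, hφ1, hφV, hφA⟩ :=
    (separableSumLp γ).exists_strongDual_eq_zero_of_notMem_topologicalClosure hx
  obtain ⟨γ₀, _, h₀⟩ := exists_measure_real_eq_add_dual γ φ hφ1
  obtain ⟨γ₁, _, h₁⟩ := exists_measure_real_eq_add_dual γ (-φ) (by rwa [norm_neg])
  have heq : γ₀ = γ₁ := by
    refine hγ.2 γ₀ γ₁ (1 / 2) (by norm_num) (NNReal.half_lt_self one_ne_zero)
      (hγ.1.of_real_eq_add_dual hφV h₀)
      (hγ.1.of_real_eq_add_dual (fun h hh ↦ by simp [hφV h hh]) h₁) ?_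
    ext B hB
    rw [← measureReal_eq_measureReal_iff]
    have half : (1 - 1 / 2 : ℝ≥0) = 1 / 2 := by
      rw [tsub_eq_iff_eq_add_of_le (by norm_num)]
      norm_num
    rw [half, measureReal_add_apply, measureReal_nnreal_smul_apply,
      measureReal_nnreal_smul_apply, h₀ B hB, h₁ B hB]
    simp only [neg_apply]
    push_cast
    ring
  have h := h₀ A hA
  rw [heq, h₁ A hA, neg_apply] at h
  exact hφA (by linarith)

lemma IsExtremalCoupling.exists_tendsto_indicator [IsFiniteMeasure γ]
    (hγ : IsExtremalCoupling γ μ ν) {A : Set (X × Y)} (hA : MeasurableSet A) :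
    ∃ (f : ℕ → X → ℝ) (g : ℕ → Y → ℝ), ∀ᵐ z ∂γ,
      Filter.Tendsto (fun n ↦ f n z.1 + g n z.2) Filter.atTop
        (nhds (A.indicator (fun _ ↦ 1) z)) := by
  have hmem := hγ.indicatorConstLp_mem_topologicalClosure hA
  rw [← SetLike.mem_coe, Submodule.topologicalClosure_coe, mem_closure_iff_seq_limit] at hmem
  obtain ⟨h, hV, hlim⟩ := hmem
  obtain ⟨n, -, hn⟩ := (tendstoInMeasure_of_tendsto_Lp hlim).exists_seq_tendsto_ae
  choose f g hfg using hV
  refine ⟨fun k ↦ f (n k), fun k ↦ g (n k), ?_⟩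
  filter_upwards [hn, ae_all_iff.2 hfg, indicatorConstLp_coeFn (p := 1) (hs := hA)
    (hμs := measure_ne_top γ A) (c := (1 : ℝ))] with z hz1 hz2 hz3
  rw [← hz3]
  exact hz1.congr fun k ↦ hz2 (n k)

end Extremal

section Graph

variable {X Y : Type*}

/-- The bipartite graph on `X ⊕ Y` whose edges are the points of `Z ⊆ X × Y`. -/
def bipartiteGraphOf (Z : Set (X × Y)) : SimpleGraph (X ⊕ Y) where
  Adj
    | .inl x, .inr y => (x, y) ∈ Z
    | .inr y, .inl x => (x, y) ∈ Z
    | _, _ => False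
  symm := ⟨by rintro (x | y) (x' | y') h <;> exact h⟩
  loopless := ⟨by rintro (x | y) h <;> exact h⟩

/-- The two-colouring of `bipartiteGraphOf Z` by the two summands. -/
def bipartiteGraphOfColoring (Z : Set (X × Y)) : (bipartiteGraphOf Z).Coloring Bool :=
  SimpleGraph.Coloring.mk Sum.isRight
    (by rintro (x | y) (x' | y') h <;> first | exact h.elim | simp)

/-- Sums `f n x + g n y` that tend to zero along the edges of a walk telescope. -/
lemma tendsto_potential_of_walk {Z : Set (X × Y)} (f : ℕ → X → ℝ) (g : ℕ → Y → ℝ)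
    {a b : X ⊕ Y} (p : (bipartiteGraphOf Z).Walk a b)
    (h : ∀ x y, s(Sum.inl x, Sum.inr y) ∈ p.edges →
      Filter.Tendsto (fun n ↦ f n x + g n y) Filter.atTop (nhds 0)) :
    Filter.Tendsto (fun n ↦ Sum.elim (f n) (-g n) a - Sum.elim (f n) (-g n) b)
      Filter.atTop (nhds 0) := by
  induction p with
  | nil => simp
  | @cons u v w huv q ih =>
    have hq := ih fun x y hxy ↦ h x y (by simp [hxy])
    have he : Filter.Tendsto (fun n ↦ Sum.elim (f n) (-g n) u - Sum.elim (f n) (-g n) v)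
        Filter.atTop (nhds 0) := by
      rcases u with x | y <;> rcases v with x' | y'
      · exact huv.elim
      · refine (h x y' (by simp)).congr fun n ↦ ?_
        simp
      · have := (h x' y (by simp [Sym2.eq_swap])).neg
        rw [neg_zero] at this
        refine this.congr fun n ↦ ?_
        simp
        ring
      · exact huv.elim
    have := he.add hq
    rw [add_zero] at this
    exact this.congr fun n ↦ by ring

/-- If sequences `f n x + g n y` converge on `Z` to indicators of enough sets to isolate any
point of `Z` from finitely many others, then `Z` contains no cycle. -/
lemma bipartiteGraphOf_isAcyclic {Z : Set (X × Y)}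
    (h : ∀ z ∈ Z, ∀ F : Set (X × Y), F.Finite → z ∉ F →
      ∃ U : Set (X × Y), z ∈ U ∧ Disjoint U F ∧ ∃ (f : ℕ → X → ℝ) (g : ℕ → Y → ℝ),
        ∀ w ∈ Z, Filter.Tendsto (fun n ↦ f n w.1 + g n w.2) Filter.atTop
          (nhds (U.indicator (fun _ ↦ 1) w))) :
    (bipartiteGraphOf Z).IsAcyclic := by
  have key : ∀ x y, (x, y) ∈ Z → (bipartiteGraphOf Z).IsBridge s(.inl x, .inr y) := by
    intro x y hxy
    rw [SimpleGraph.isBridge_iff_forall_walk_mem_edges]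
    intro p
    by_contra hp
    have hinj : Function.Injective fun w : X × Y ↦ s(Sum.inl w.1, Sum.inr w.2) := by
      rintro ⟨x, y⟩ ⟨x', y'⟩ h
      simpa using h
    obtain ⟨U, hzU, hUF, f, g, hfg⟩ := h (x, y) hxy
      ((fun w : X × Y ↦ s(Sum.inl w.1, Sum.inr w.2)) ⁻¹' {e | e ∈ p.edges})
      ((List.finite_toSet p.edges).preimage hinj.injOn) hp
    have h0 := tendsto_potential_of_walk f g p fun x' y' he ↦ by
      have hZ : (x', y') ∈ Z := p.adj_of_mem_edges he
      have hU : (x', y') ∉ U := fun hU ↦ disjoint_left.1 hUF hU he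
      simpa [hU] using hfg _ hZ
    have h1 := hfg _ hxy
    rw [indicator_of_mem hzU] at h1
    refine zero_ne_one (tendsto_nhds_unique h0 (h1.congr fun n ↦ ?_))
    simp
  rw [SimpleGraph.isAcyclic_iff_forall_adj_isBridge]
  rintro (x | y) (x' | y') h
  · exact h.elim
  · exact key _ _ h
  · rw [Sym2.eq_swap]
    exact key _ _ h
  · exact h.elim

/-- In a forest, a vertex has at most one neighbour closer to a given root. -/
lemma SimpleGraph.IsAcyclic.eq_of_adj_of_dist_add_one {V : Type*} {G : SimpleGraph V}
    (hG : G.IsAcyclic) {r v a b : V} (hr : G.Reachable r v) (ha : G.Adj a v) (hb : G.Adj b v)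
    (hda : G.dist r a + 1 = G.dist r v) (hdb : G.dist r b + 1 = G.dist r v) : a = b := by
  have path : ∀ c, G.Adj c v → G.dist r c + 1 = G.dist r v →
      ∃ p : G.Walk r v, p.IsPath ∧ p.penultimate = c := by
    intro c hc hdc
    obtain ⟨q, hq⟩ := (hr.trans hc.symm.reachable).exists_walk_length_eq_dist
    refine ⟨q.concat hc, (q.concat hc).isPath_of_length_eq_dist ?_, by simp⟩
    rw [SimpleGraph.Walk.length_concat, hq, hdc]
  obtain ⟨p, hp, rfl⟩ := path a ha hda
  obtain ⟨q, hq, rfl⟩ := path b hb hdb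
  have := (hG.subsingleton_path r v).elim ⟨p, hp⟩ ⟨q, hq⟩
  rw [Subtype.mk.injEq] at this
  rw [this]

/-- Half-levels on `X` and `Y` such that every point of `Z` joins consecutive levels and
each point has at most one partner on the level below yield a numbered limb system. -/
lemma exists_numberedLimbSystem_of_levels [Nonempty X] [Nonempty Y] {Z : Set (X × Y)}
    (a : X → ℕ) (b : Y → ℕ)
    (hab : ∀ x y, (x, y) ∈ Z → b y = a x ∨ b y = a x + 1)
    (hX : ∀ x y y', (x, y) ∈ Z → (x, y') ∈ Z → b y = a x → b y' = a x → y = y')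
    (hY : ∀ x x' y, (x, y) ∈ Z → (x', y) ∈ Z → b y = a x + 1 → b y = a x' + 1 → x = x') :
    ∃ L : NumberedLimbSystem X Y, Z ⊆ L.limbSet := by
  classical
  have hfX : ∀ x, ∃ y, (∃ y', (x, y') ∈ Z ∧ b y' = a x) → (x, y) ∈ Z ∧ b y = a x := fun x ↦ by
    by_cases h : ∃ y', (x, y') ∈ Z ∧ b y' = a x
    · exact ⟨h.choose, fun _ ↦ h.choose_spec⟩
    · exact ⟨Classical.arbitrary Y, fun h' ↦ (h h').elim⟩
  have hfY : ∀ y, ∃ x, (∃ x', (x', y) ∈ Z ∧ b y = a x' + 1) → (x, y) ∈ Z ∧ b y = a x + 1 :=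
    fun y ↦ by
    by_cases h : ∃ x', (x', y) ∈ Z ∧ b y = a x' + 1
    · exact ⟨h.choose, fun _ ↦ h.choose_spec⟩
    · exact ⟨Classical.arbitrary X, fun h' ↦ (h h').elim⟩
  choose f hf using hfX
  choose g hg using hfY
  refine ⟨{
    fodd := fun _ ↦ f
    domOdd := fun i ↦ {x | a x = i ∧ ∃ y, (x, y) ∈ Z ∧ b y = a x}
    feven := fun _ ↦ g
    domEven := fun i ↦ {y | b y = i ∧ ∃ x, (x, y) ∈ Z ∧ b y = a x + 1}
    Iodd := fun i ↦ {x | a x = i}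
    Ieven := fun i ↦ {y | b y = i}
    disjoint_Iodd := fun i j hij ↦ disjoint_left.2 fun x hi hj ↦ hij (hi.symm.trans hj)
    union_Iodd := by ext; simp
    disjoint_Ieven := fun i j hij ↦ disjoint_left.2 fun y hi hj ↦ hij (hi.symm.trans hj)
    union_Ieven := by ext; simp
    even_subset := ?_
    odd_subset := ?_ }, ?_⟩
  · rintro i y (hy | ⟨x, ⟨hx, hxy⟩, rfl⟩)
    · exact hy.1
    · exact (hf x hxy).2.trans hx
  · rintro i x (hx | ⟨y, ⟨hy, hxy⟩, rfl⟩)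
    · exact hx.1
    · have := (hg y hxy).2
      change a (g y) = i
      lia
  · rintro ⟨x, y⟩ hz
    rcases hab x y hz with h | h
    · refine Or.inl (mem_iUnion.2 ⟨a x, ⟨rfl, y, hz, h⟩, ?_⟩)
      have := hf x ⟨y, hz, h⟩
      exact hX x _ _ hz this.1 h this.2
    · refine Or.inr (mem_iUnion.2 ⟨a x, ⟨h, x, hz, h⟩, ?_⟩)
      have := hg y ⟨x, hz, h⟩
      exact hY _ _ y hz this.1 h this.2

/-- An acyclic relation is contained in a numbered limb system. -/
lemma exists_numberedLimbSystem_of_isAcyclic [Nonempty X] [Nonempty Y] {Z : Set (X × Y)}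
    (hZ : (bipartiteGraphOf Z).IsAcyclic) :
    ∃ L : NumberedLimbSystem X Y, Z ⊆ L.limbSet := by
  classical
  set G := bipartiteGraphOf Z
  have hroot : ∀ c : G.ConnectedComponent, ∃ r : Y,
      (∃ y : Y, G.connectedComponentMk (.inr y) = c) → G.connectedComponentMk (.inr r) = c := by
    intro c
    by_cases h : ∃ y : Y, G.connectedComponentMk (.inr y) = c
    · exact ⟨h.choose, fun _ ↦ h.choose_spec⟩
    · exact ⟨Classical.arbitrary Y, fun h' ↦ (h h').elim⟩
  choose root hroot using hroot
  let r : X ⊕ Y → X ⊕ Y := fun v ↦ .inr (root (G.connectedComponentMk v))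
  have hr_adj : ∀ {u v}, G.Adj u v → r u = r v := fun {u v} huv ↦ by
    simp only [r, SimpleGraph.ConnectedComponent.connectedComponentMk_eq_of_adj huv]
  have hr_inr : ∀ y : Y, G.Reachable (r (.inr y)) (.inr y) := fun y ↦
    SimpleGraph.ConnectedComponent.exact (hroot _ ⟨y, rfl⟩)
  have hr_inl : ∀ {x y}, (x, y) ∈ Z → G.Reachable (r (.inl x)) (.inl x) := fun {x y} hxy ↦ by
    have hadj : G.Adj (.inr y) (.inl x) := hxy
    rw [← hr_adj hadj]
    exact (hr_inr y).trans hadj.reachable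
  have heven : ∀ y, Even (G.dist (r (.inr y)) (.inr y)) := fun y ↦ by
    obtain ⟨p, hp⟩ := (hr_inr y).exists_walk_length_eq_dist
    rw [← hp, (bipartiteGraphOfColoring Z).even_length_iff_congr p]
    exact Iff.rfl
  have hodd : ∀ {x y}, (x, y) ∈ Z → Odd (G.dist (r (.inl x)) (.inl x)) := fun {x y} hxy ↦ by
    obtain ⟨p, hp⟩ := (hr_inl hxy).exists_walk_length_eq_dist
    rw [← hp, ← Nat.not_even_iff_odd, (bipartiteGraphOfColoring Z).even_length_iff_congr p]
    exact fun h ↦ Bool.false_ne_true (h.1 rfl)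
  have hdist : ∀ {x y}, (x, y) ∈ Z →
      G.dist (r (.inr y)) (.inr y) = G.dist (r (.inl x)) (.inl x) + 1 ∨
      G.dist (r (.inr y)) (.inr y) + 1 = G.dist (r (.inl x)) (.inl x) := fun {x y} hxy ↦ by
    have hadj : G.Adj (.inl x) (.inr y) := hxy
    have h1 := hadj.diff_dist_adj (u := r (.inl x))
    have h2 := heven y
    have h3 := hodd hxy
    rw [← hr_adj hadj] at h2 ⊢
    grind
  refine exists_numberedLimbSystem_of_levels
    (fun x ↦ G.dist (r (.inl x)) (.inl x) / 2) (fun y ↦ G.dist (r (.inr y)) (.inr y) / 2)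
    (fun x y hxy ↦ ?_) (fun x y y' hxy hxy' h h' ↦ ?_) (fun x x' y hxy hxy' h h' ↦ ?_)
  · have := hdist hxy
    have := heven y
    have := hodd hxy
    grind
  · have hadj : G.Adj (.inr y) (.inl x) := hxy
    have hadj' : G.Adj (.inr y') (.inl x) := hxy'
    have e := hdist hxy
    have e' := hdist hxy'
    have o := hodd hxy
    have v := heven y
    have v' := heven y'
    rw [hr_adj hadj] at e v h
    rw [hr_adj hadj'] at e' v' h'
    exact Sum.inr_injective (hZ.eq_of_adj_of_dist_add_one (hr_inl hxy) hadj hadj'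
      (by grind) (by grind))
  · have hadj : G.Adj (.inl x) (.inr y) := hxy
    have hadj' : G.Adj (.inl x') (.inr y) := hxy'
    have e := hdist hxy
    have e' := hdist hxy'
    have o := hodd hxy
    have o' := hodd hxy'
    have v := heven y
    rw [hr_adj hadj] at e o h
    rw [hr_adj hadj'] at e' o' h'
    exact Sum.inl_injective (hZ.eq_of_adj_of_dist_add_one (hr_inr y) hadj hadj'
      (by grind) (by grind))

end Graph

/-- An extremal coupling vanishes outside an acyclic relation. -/
lemma IsExtremalCoupling.exists_isAcyclic {X Y : Type*}
    [MetricSpace X] [TopologicalSpace.SeparableSpace X] [MeasurableSpace X] [BorelSpace X]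
    [MetricSpace Y] [TopologicalSpace.SeparableSpace Y] [MeasurableSpace Y] [BorelSpace Y]
    {μ : Measure X} {ν : Measure Y} {γ : Measure (X × Y)} [IsFiniteMeasure γ]
    (hγ : IsExtremalCoupling γ μ ν) :
    ∃ Z : Set (X × Y), γ Zᶜ = 0 ∧ (bipartiteGraphOf Z).IsAcyclic := by
  have : SecondCountableTopology X := UniformSpace.secondCountable_of_separable X
  have : SecondCountableTopology Y := UniformSpace.secondCountable_of_separable Y
  have hB := TopologicalSpace.isBasis_countableBasis (X × Y)
  have hcount := TopologicalSpace.countable_countableBasis (X × Y)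
  choose! f g hfg using fun (U : Set (X × Y))
    (hU : U ∈ TopologicalSpace.countableBasis (X × Y)) ↦
      hγ.exists_tendsto_indicator (hB.isOpen hU).measurableSet
  refine ⟨{z | ∀ U ∈ TopologicalSpace.countableBasis (X × Y),
    Filter.Tendsto (fun n ↦ f U n z.1 + g U n z.2) Filter.atTop
      (nhds (U.indicator (fun _ ↦ 1) z))}, (ae_ball_iff hcount).2 hfg,
    bipartiteGraphOf_isAcyclic fun z _ F hF hzF ↦ ?_⟩
  obtain ⟨U, hU, hzU, hUF⟩ := hB.exists_subset_of_mem_open (u := Fᶜ) hzF hF.isClosed.isOpen_compl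
  exact ⟨U, hzU, disjoint_left.2 fun w hw ↦ hUF hw, f U, g U, fun w hw ↦ hw U hU⟩

/-- **Hestir–Williams necessary condition.**  Every extremal measure `γ ∈ Γ(μ,ν)`
vanishes outside some numbered limb system `S ⊆ X × Y`. -/
theorem extremal_vanishes_outside_numberedLimbSystem
    {X Y : Type*}
    [MetricSpace X] [TopologicalSpace.SeparableSpace X] [MeasurableSpace X] [BorelSpace X]
    [MetricSpace Y] [TopologicalSpace.SeparableSpace Y] [MeasurableSpace Y] [BorelSpace Y]
    (μ : Measure X) (ν : Measure Y) [IsProbabilityMeasure μ] [IsProbabilityMeasure ν]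
    (γ : Measure (X × Y)) (hγ : IsExtremalCoupling γ μ ν) :
    ∃ L : NumberedLimbSystem X Y, γ L.limbSetᶜ = 0 := by
  have hμ : γ.map Prod.fst = μ := hγ.1.1
  have : IsFiniteMeasure γ := by
    have : IsFiniteMeasure (γ.map Prod.fst) := by rw [hμ]; infer_instance
    exact Measure.isFiniteMeasure_of_map measurable_fst.aemeasurable
  have : Nonempty X := μ.nonempty_of_neZero
  have : Nonempty Y := ν.nonempty_of_neZero
  obtain ⟨Z, hZ, hacyclic⟩ := hγ.exists_isAcyclic
  obtain ⟨L, hL⟩ := exists_numberedLimbSystem_of_isAcyclic hacyclic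
  exact ⟨L, measure_mono_null (compl_subset_compl.2 hL) hZ⟩
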